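/- The new smoothing function s₃^{#}(r) = erf(r) − (2/9)·r·(9 + 6r² − 4r⁴)·e^{−r²}/√π vanishes to fifth order at 0: the limit of s₃^{#}(r)/r⁵ as r → 0 (r ≠ 0) exists and equals 64/(45√π). -/

import Mathlib

open MeasureTheory Real Filter

/-- The error function `erf(r) = (2/√π) ∫₀^r e^{−t²} dt`. -/
noncomputable def erf (r : ℝ) : ℝ :=
  (2 / Real.sqrt Real.pi) * ∫ t in (0:ℝ)..r, Real.exp (-t ^ 2)

/-- The new smoothing function `s₃^{#}(r) = erf(r) − (2/9)r(9 + 6r² − 4r⁴)e^{−r²}/√π`. -/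
noncomputable def s3SharpNew (r : ℝ) : ℝ :=
  erf r - (2 / 9) * r * (9 + 6 * r ^ 2 - 4 * r ^ 4) * Real.exp (-r ^ 2) / Real.sqrt Real.pi

theorem hasDerivAt_erf (r : ℝ) :
    HasDerivAt erf (2 / Real.sqrt Real.pi * Real.exp (-r ^ 2)) r := by
  have hc : Continuous fun t : ℝ => Real.exp (-t ^ 2) := by fun_prop
  exact (hc.integral_hasStrictDerivAt 0 r).hasDerivAt.const_mul _

theorem hasDerivAt_s3SharpNew (r : ℝ) :
    HasDerivAt s3SharpNew
      (16 / 9 * r ^ 4 * (4 - r ^ 2) * Real.exp (-r ^ 2) / Real.sqrt Real.pi) r := by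
  have hexp : HasDerivAt (fun x : ℝ => Real.exp (-x ^ 2)) (Real.exp (-r ^ 2) * -(2 * r)) r := by
    simpa using ((hasDerivAt_id r).pow 2).neg.exp
  have hpoly : HasDerivAt (fun x : ℝ => 2 / 9 * x * (9 + 6 * x ^ 2 - 4 * x ^ 4))
      (2 / 9 * (9 + 18 * r ^ 2 - 20 * r ^ 4)) r := by
    refine (((hasDerivAt_id' r).const_mul (2 / 9)).mul
      ((((hasDerivAt_pow 2 r).const_mul 6).const_add 9).sub
        ((hasDerivAt_pow 4 r).const_mul 4))).congr_deriv ?_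
    norm_num
    ring
  refine ((hasDerivAt_erf r).sub
    ((hpoly.mul hexp).div_const (Real.sqrt Real.pi))).congr_deriv ?_
  ring

theorem s3SharpNew_zero : s3SharpNew 0 = 0 := by
  simp [s3SharpNew, erf]

/-- `s₃^{#}(r)/r⁵ → 64/(45√π)` as `r → 0`, `r ≠ 0`. -/
theorem tendsto_s3SharpNew_div_pow_five :
    Filter.Tendsto (fun r : ℝ => s3SharpNew r / r ^ 5) (nhdsWithin 0 {0}ᶜ)
      (nhds (64 / (45 * Real.sqrt Real.pi))) := by
  have hne : ∀ᶠ r : ℝ in nhdsWithin 0 {0}ᶜ, r ≠ 0 := eventually_mem_nhdsWithin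
  refine HasDerivAt.lhopital_zero_nhdsNE (Eventually.of_forall hasDerivAt_s3SharpNew)
    (Eventually.of_forall fun r => hasDerivAt_pow 5 r) ?_ ?_ ?_ ?_
  · filter_upwards [hne] with r hr
    positivity
  · have h := (hasDerivAt_s3SharpNew 0).continuousAt.tendsto
    rw [s3SharpNew_zero] at h
    exact h.mono_left nhdsWithin_le_nhds
  · have h := (continuous_pow (M := ℝ) 5).tendsto 0
    rw [zero_pow (by norm_num)] at h
    exact h.mono_left nhdsWithin_le_nhds
  · have hc : Continuous fun r : ℝ =>
        16 / 45 * (4 - r ^ 2) * Real.exp (-r ^ 2) / Real.sqrt Real.pi := by fun_prop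
    have h := (hc.tendsto 0).mono_left (nhdsWithin_le_nhds (s := {0}ᶜ))
    have hval : 16 / 45 * (4 - (0 : ℝ) ^ 2) * Real.exp (-0 ^ 2) / Real.sqrt Real.pi
        = 64 / (45 * Real.sqrt Real.pi) := by
      norm_num
      ring
    rw [hval] at h
    refine h.congr' ?_
    filter_upwards [hne] with r hr
    push_cast
    field_simp
    ring
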